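/- arXiv:2005.10769 — 2 statements merged into one kernel-verified Lean document; each statement's English description precedes it below -/
import Mathlib

section
/- For every n ≥ 0, the polynomials S_n ∈ ℤ[q] satisfy the recurrence q^{4n+15} S_n + q^{2n+11}(1+q)(S_{n+3} − S_{n+4}) − q³ S_{n+5} + (1+q+q²)(q S_{n+6} − S_{n+7}) + S_{n+8} = 0. -/
open PowerSeries

/-- `(q)_n = ∏_{j=1}^n (1 - q^j)` in `ℤ⟦q⟧`. -/
noncomputable def qPoch (n : ℕ) : PowerSeries ℤ :=
  ∏ j ∈ Finset.range n, (1 - (X : PowerSeries ℤ) ^ (j + 1))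

/-- The multiplicative inverse of `(q)_n` in `ℤ⟦q⟧` (its constant term is `1`). -/
noncomputable def qPochInv (n : ℕ) : PowerSeries ℤ := invOfUnit (qPoch n) 1

/-- The Gaussian binomial coefficient `binom(m,k)_q = (q)_m/((q)_k (q)_{m-k})`
for integer arguments `0 ≤ k ≤ m`, and `0` for negative or out-of-range
arguments.  (It is a polynomial in `q`; we regard it inside `ℤ⟦q⟧`.) -/
noncomputable def qBinom (m k : ℤ) : PowerSeries ℤ :=
  if 0 ≤ k ∧ k ≤ m then qPoch m.toNat * qPochInv k.toNat * qPochInv (m - k).toNat else 0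

/-- `S_n = ∑_{k≥0} q^{2k²} binom(n-k, 2k)_q`; all summands with `k > n` vanish,
so the sum is taken over `k ≤ n`. -/
noncomputable def S (n : ℕ) : PowerSeries ℤ :=
  ∑ k ∈ Finset.range (n + 1),
    (X : PowerSeries ℤ) ^ (2 * k ^ 2) * qBinom ((n : ℤ) - k) (2 * k)

/-- `T_n = ∑_{m,k≥0} q^{m²+3km+4k²} (binom(n-3k-m,k)_q binom(n-4k-m,m)_q
- q^k binom(n-3k-m-1,k)_q binom(n-4k-m-1,m-1)_q)`; all summands with `m > n` or
`k > n` vanish, so the sum is taken over `m, k ≤ n`. -/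
noncomputable def T (n : ℕ) : PowerSeries ℤ :=
  ∑ m ∈ Finset.range (n + 1), ∑ k ∈ Finset.range (n + 1),
    (X : PowerSeries ℤ) ^ (m ^ 2 + 3 * k * m + 4 * k ^ 2) *
      (qBinom ((n : ℤ) - 3 * k - m) k * qBinom ((n : ℤ) - 4 * k - m) m -
        (X : PowerSeries ℤ) ^ k * qBinom ((n : ℤ) - 3 * k - m - 1) k *
          qBinom ((n : ℤ) - 4 * k - m - 1) ((m : ℤ) - 1))

namespace SRec

/-- q-Pascal triangle. -/
noncomputable def g : ℕ → ℕ → PowerSeries ℤ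
  | _, 0 => 1
  | 0, _ + 1 => 0
  | m + 1, r + 1 => g m r + (X : PowerSeries ℤ) ^ (r + 1) * g m (r + 1)

lemma g_zero (m : ℕ) : g m 0 = 1 := by cases m <;> simp [g]

lemma g_pascal (m r : ℕ) :
    g (m + 1) (r + 1) = g m r + (X : PowerSeries ℤ) ^ (r + 1) * g m (r + 1) := by
  simp [g]

lemma g_gt (m : ℕ) : ∀ r, m < r → g m r = 0 := by
  induction m with
  | zero => intro r h; obtain ⟨s, rfl⟩ := Nat.exists_eq_succ_of_ne_zero (by omega : r ≠ 0); simp [g]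
  | succ m ih =>
    intro r h
    obtain ⟨s, rfl⟩ := Nat.exists_eq_succ_of_ne_zero (by omega : r ≠ 0)
    rw [Nat.succ_eq_add_one, g_pascal, ih s (by omega), ih (s + 1) (by omega)]; simp

lemma qPoch_succ (n : ℕ) : qPoch (n + 1) = qPoch n * (1 - (X : PowerSeries ℤ) ^ (n + 1)) := by
  simp [qPoch, Finset.prod_range_succ]

lemma qPoch_zero : qPoch 0 = 1 := by simp [qPoch]

lemma qPoch_const (n : ℕ) : constantCoeff (qPoch n) = 1 := by
  simp [qPoch, map_prod]

lemma qPoch_inv (n : ℕ) : qPoch n * qPochInv n = 1 := by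
  unfold qPochInv
  exact mul_invOfUnit _ _ (by simp [qPoch_const])

lemma qPoch_ne (n : ℕ) : qPoch n ≠ 0 := by
  intro h
  have := qPoch_inv n
  simp [h] at this

lemma g_fact (m : ℕ) : ∀ r d, r + d = m → g m r * (qPoch r * qPoch d) = qPoch m := by
  induction m with
  | zero =>
    intro r d h
    obtain ⟨rfl, rfl⟩ : r = 0 ∧ d = 0 := by omega
    simp [g_zero, qPoch_zero]
  | succ m ih =>
    intro r d h
    rcases r with _ | r
    · obtain rfl : d = m + 1 := by omega
      simp [g_zero, qPoch_zero]
    · rw [g_pascal]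
      rcases d with _ | d
      · obtain rfl : r = m := by omega
        have h1 := ih r 0 rfl
        rw [g_gt r (r + 1) (by omega), qPoch_succ]
        linear_combination (1 - (X : PowerSeries ℤ) ^ (r + 1)) * h1
      · have h1 := ih r (d + 1) (by omega)
        have h2 := ih (r + 1) d (by omega)
        have e : m = r + d + 1 := by omega
        subst e
        rw [qPoch_succ] at h1 h2 ⊢
        rw [qPoch_succ d, qPoch_succ (r + d + 1)]
        linear_combination (1 - (X : PowerSeries ℤ) ^ (r + 1)) * h1 +
          (X : PowerSeries ℤ) ^ (r + 1) * (1 - (X : PowerSeries ℤ) ^ (d + 1)) * h2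

/-- second Pascal rule -/
lemma g_pascal2 (r d : ℕ) :
    g (r + d + 1) (r + 1) = g (r + d) (r + 1) + (X : PowerSeries ℤ) ^ d * g (r + d) r := by
  rcases d with _ | d
  · rw [g_pascal, g_gt (r + 0) (r + 1) (by omega)]; simp [g_gt r (r + 1) (by omega)]
  · have h0 := g_fact (r + (d + 1) + 1) (r + 1) (d + 1) (by omega)
    have h1 := g_fact (r + (d + 1)) r (d + 1) (by omega)
    have h2 := g_fact (r + (d + 1)) (r + 1) d (by omega)
    have hne : qPoch (r + 1) * qPoch (d + 1) ≠ 0 := mul_ne_zero (qPoch_ne _) (qPoch_ne _)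
    apply mul_right_cancel₀ hne
    rw [h0, qPoch_succ (r + (d + 1))]
    rw [qPoch_succ d] at h1 ⊢
    rw [qPoch_succ r] at h2 ⊢
    linear_combination -(1 - (X : PowerSeries ℤ) ^ (d + 1)) * h2 -
      (X : PowerSeries ℤ) ^ (d + 1) * (1 - (X : PowerSeries ℤ) ^ (r + 1)) * h1

lemma qBinom_eq (n k : ℕ) : qBinom ((n : ℤ) - k) (2 * k) = g (n - k) (2 * k) := by
  unfold qBinom
  split_ifs with h
  · have e1 : ((n : ℤ) - k).toNat = n - k := by omega
    have e2 : (2 * (k : ℤ)).toNat = 2 * k := by omega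
    have e3 : ((n : ℤ) - k - 2 * k).toNat = n - k - 2 * k := by omega
    rw [e1, e2, e3, ← g_fact (n - k) (2 * k) (n - k - 2 * k) (by omega)]
    have a := qPoch_inv (2 * k)
    have b := qPoch_inv (n - k - 2 * k)
    linear_combination g (n - k) (2 * k) * (qPoch (n - k - 2 * k) * qPochInv (n - k - 2 * k) * a + b)
  · rw [g_gt]; omega

/-- even sums -/
noncomputable def E (M : ℕ) (e : ℕ → ℕ) (n : ℕ) : PowerSeries ℤ :=
  ∑ k ∈ Finset.range M, (X : PowerSeries ℤ) ^ (e k) * g (n - k) (2 * k)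

/-- odd sums -/
noncomputable def O (M : ℕ) (e : ℕ → ℕ) (n : ℕ) : PowerSeries ℤ :=
  ∑ k ∈ Finset.range M, (X : PowerSeries ℤ) ^ (e k) * g (n - k) (2 * k + 1)

lemma S_eq (M n : ℕ) (h : n < M) : S n = E M (fun k => 2 * k ^ 2) n := by
  unfold S E
  simp only [qBinom_eq]
  apply Finset.sum_subset
  · intro x; simp only [Finset.mem_range]; omega
  · intro x _ hx
    simp only [Finset.mem_range] at hx
    rw [g_gt _ _ (by omega), mul_zero]

/-- difference rule, odd -/
lemma O_diff (M n : ℕ) (e f : ℕ → ℕ) (h : ∀ k, e k = f k + 3 * k) :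
    O M e (n + 1) - O M e n = (X : PowerSeries ℤ) ^ n * E M f n := by
  unfold O E
  rw [← Finset.sum_sub_distrib, Finset.mul_sum]
  refine Finset.sum_congr rfl fun k _ => ?_
  rw [h]
  by_cases hk : 3 * k ≤ n
  · obtain ⟨d, rfl⟩ := Nat.exists_eq_add_of_le hk
    have := g_pascal2 (2 * k) d
    rw [show 3 * k + d + 1 - k = 2 * k + d + 1 by omega, show 3 * k + d - k = 2 * k + d by omega,
      this]
    ring
  · rw [g_gt _ _ (by omega), g_gt _ _ (by omega), g_gt _ _ (by omega)]; ring

/-- Pascal rule, odd -/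
lemma O_pascal (M n : ℕ) (e f : ℕ → ℕ) (h : ∀ k, f k = e k + 2 * k) :
    O M e (n + 1) = E M e n + X * O M f n := by
  unfold O E
  rw [Finset.mul_sum, ← Finset.sum_add_distrib]
  refine Finset.sum_congr rfl fun k _ => ?_
  rw [h]
  by_cases hk : k ≤ n
  · rw [show n + 1 - k = n - k + 1 by omega, g_pascal]
    ring
  · rw [g_gt _ _ (by omega), g_gt _ _ (by omega), g_gt _ _ (by omega)]; ring

lemma O_last (M n : ℕ) (e : ℕ → ℕ) (h : n < M) : O (M + 1) e n = O M e n := by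
  unfold O
  rw [Finset.sum_range_succ, g_gt _ _ (by omega)]; simp

/-- difference rule, even -/
lemma E_diff (M n c d : ℕ) (e f : ℕ → ℕ) (hM : n < M)
    (h : ∀ k, e (k + 1) + n + c = f k + 3 * k + 1 + d) :
    (X : PowerSeries ℤ) ^ c * (E (M + 1) e (n + 2) - E (M + 1) e (n + 1)) =
      (X : PowerSeries ℤ) ^ d * O (M + 1) f n := by
  rw [O_last M n f hM]
  unfold O E
  rw [← Finset.sum_sub_distrib, Finset.sum_range_succ', Finset.mul_sum]
  simp only [Nat.mul_zero, g_zero, sub_self, add_zero]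
  rw [Finset.mul_sum]
  refine Finset.sum_congr rfl fun k _ => ?_
  rw [show n + 2 - (k + 1) = n + 1 - k by omega, show n + 1 - (k + 1) = n - k by omega]
  by_cases hk : 3 * k + 1 ≤ n
  · obtain ⟨t, rfl⟩ := Nat.exists_eq_add_of_le hk
    have := g_pascal2 (2 * k + 1) t
    rw [show 3 * k + 1 + t + 1 - k = 2 * k + 1 + t + 1 by omega,
      show 3 * k + 1 + t - k = 2 * k + 1 + t by omega, show 2 * (k + 1) = 2 * k + 1 + 1 by ring,
      this]
    have hh : c + e (k + 1) + t = d + f k := by have := h k; omega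
    have hx : (X : PowerSeries ℤ) ^ c * X ^ e (k + 1) * X ^ t = X ^ d * X ^ f k := by
      rw [← pow_add, ← pow_add, ← pow_add, hh]
    linear_combination g (2 * k + 1 + t) (2 * k + 1) * hx
  · rw [g_gt _ _ (by omega), g_gt _ _ (by omega), g_gt _ _ (by omega)]; ring

/-- Pascal rule, even -/
lemma E_pascal (M n : ℕ) (e f h : ℕ → ℕ) (hM : n < M) (hf : ∀ k, f k = e k + 2 * k)
    (hh : ∀ k, e (k + 1) = h k + 1) :
    E (M + 1) e (n + 2) = E (M + 1) f (n + 1) + X * O (M + 1) h n := by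
  rw [O_last M n h hM]
  unfold O E
  rw [Finset.sum_range_succ', Finset.sum_range_succ' (fun k => X ^ f k * _)]
  have h0 : f 0 = e 0 := by simp [hf]
  simp only [Nat.mul_zero, g_zero, h0]
  rw [Finset.mul_sum, add_right_comm, ← Finset.sum_add_distrib]
  congr 1
  refine Finset.sum_congr rfl fun k _ => ?_
  rw [hf, hh, show n + 2 - (k + 1) = n + 1 - k by omega, show n + 1 - (k + 1) = n - k by omega,
    show 2 * (k + 1) = 2 * k + 1 + 1 by ring]
  by_cases hk : k ≤ n
  · rw [show n + 1 - k = n - k + 1 by omega, g_pascal]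
    ring
  · rw [g_gt _ _ (by omega), g_gt _ _ (by omega), g_gt _ _ (by omega)]; ring

end SRec

/-- the recurrence
`q^{4n+15} S_n + q^{2n+11}(1+q)(S_{n+3} - S_{n+4}) - q³ S_{n+5}
+ (1+q+q²)(q S_{n+6} - S_{n+7}) + S_{n+8} = 0`. -/
theorem S_recurrence (n : ℕ) :
    (X : PowerSeries ℤ) ^ (4 * n + 15) * S n +
      (X : PowerSeries ℤ) ^ (2 * n + 11) * (1 + X) * (S (n + 3) - S (n + 4)) -
      (X : PowerSeries ℤ) ^ 3 * S (n + 5) +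
      (1 + X + (X : PowerSeries ℤ) ^ 2) * (X * S (n + 6) - S (n + 7)) +
      S (n + 8) = 0 := by
  obtain ⟨M, hM⟩ : ∃ M, M = n + 20 := ⟨_, rfl⟩
  let V1 := SRec.O (M + 1) (fun k => 2 * k ^ 2 + k)
  let V3 := SRec.O (M + 1) (fun k => 2 * k ^ 2 + 3 * k)
  let P := SRec.E (M + 1) (fun k => 2 * k * (k - 1))
  let W := SRec.O (M + 1) (fun k => k * (2 * k - 1))
  let Q := SRec.E (M + 1) (fun k => k * (2 * k - 1))
  let S1 := SRec.E (M + 1) (fun k => 2 * k ^ 2 + k)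
  have t1 (j : ℕ) (hj : j < 8) : S (n + j + 2) - S (n + j + 1) =
      (X : PowerSeries ℤ) ^ (n + j + 1) * V1 (n + j) := by
    have := SRec.E_diff M (n + j) 0 (n + j + 1) (fun k => 2 * k ^ 2) (fun k => 2 * k ^ 2 + k)
      (by omega) (fun k => by ring)
    rw [SRec.S_eq (M + 1) (n + j + 2) (by omega), SRec.S_eq (M + 1) (n + j + 1) (by omega), ← this]
    ring
  have t2 (m : ℕ) : V1 (m + 1) - V1 m = (X : PowerSeries ℤ) ^ m * P m := by
    apply SRec.O_diff
    intro k
    rcases k with _ | k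
    · simp
    · simp only [Nat.add_sub_cancel]; ring
  have t3 : (X : PowerSeries ℤ) ^ 1 * (P (n + 3 + 2) - P (n + 3 + 1)) =
      (X : PowerSeries ℤ) ^ (n + 3) * W (n + 3) := by
    apply SRec.E_diff _ _ _ _ _ _ (by omega)
    intro k
    rcases k with _ | k
    · simp; omega
    · simp only [Nat.add_sub_cancel, show 2 * (k + 1) - 1 = 2 * k + 1 by omega]; ring
  have t4 : W (n + 2 + 1) = Q (n + 2) + X * V1 (n + 2) := by
    apply SRec.O_pascal
    intro k
    rcases k with _ | k
    · simp
    · simp only [show 2 * (k + 1) - 1 = 2 * k + 1 by omega]; ring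
  have t5 : V1 (n + 1 + 1) = S1 (n + 1) + X * V3 (n + 1) := by
    apply SRec.O_pascal
    intro k
    ring
  have t6 : Q (n + 2) = S1 (n + 1) + X * V3 n := by
    apply SRec.E_pascal _ _ _ _ _ (by omega)
    · intro k
      rcases k with _ | k
      · simp
      · simp only [show 2 * (k + 1) - 1 = 2 * k + 1 by omega]; ring
    · intro k
      simp only [show 2 * (k + 1) - 1 = 2 * k + 1 by omega]; ring
  have t7 : V3 (n + 1) - V3 n = (X : PowerSeries ℤ) ^ n * S n := by
    rw [SRec.S_eq (M + 1) n (by omega)]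
    apply SRec.O_diff
    intro k
    ring
  have key : W (n + 3) = (1 + X) * V1 (n + 2) - (X : PowerSeries ℤ) ^ (n + 1) * S n := by
    have t4' : W (n + 3) = Q (n + 2) + X * V1 (n + 2) := t4
    have t5' : V1 (n + 2) = S1 (n + 1) + X * V3 (n + 1) := t5
    linear_combination t4' + t6 - t5' - X * t7
  have a2 : S (n + 4) - S (n + 3) = (X : PowerSeries ℤ) ^ (n + 3) * V1 (n + 2) := t1 2 (by omega)
  have a4 : S (n + 6) - S (n + 5) = (X : PowerSeries ℤ) ^ (n + 5) * V1 (n + 4) := t1 4 (by omega)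
  have a5 : S (n + 7) - S (n + 6) = (X : PowerSeries ℤ) ^ (n + 6) * V1 (n + 5) := t1 5 (by omega)
  have a6 : S (n + 8) - S (n + 7) = (X : PowerSeries ℤ) ^ (n + 7) * V1 (n + 6) := t1 6 (by omega)
  have b4 : V1 (n + 5) - V1 (n + 4) = (X : PowerSeries ℤ) ^ (n + 4) * P (n + 4) := t2 (n + 4)
  have b5 : V1 (n + 6) - V1 (n + 5) = (X : PowerSeries ℤ) ^ (n + 5) * P (n + 5) := t2 (n + 5)
  have t3' : (X : PowerSeries ℤ) ^ 1 * (P (n + 5) - P (n + 4)) =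
      (X : PowerSeries ℤ) ^ (n + 3) * W (n + 3) := t3
  have p4 : (X : PowerSeries ℤ) ^ (2 * n + 10) * P (n + 4) =
      S (n + 7) - (1 + X) * S (n + 6) + X * S (n + 5) := by
    linear_combination X * a4 - a5 - (X : PowerSeries ℤ) ^ (n + 6) * b4
  have p5 : (X : PowerSeries ℤ) ^ (2 * n + 12) * P (n + 5) =
      S (n + 8) - (1 + X) * S (n + 7) + X * S (n + 6) := by
    linear_combination X * a5 - a6 - (X : PowerSeries ℤ) ^ (n + 7) * b5
  linear_combination (X : PowerSeries ℤ) ^ (2 * n + 11) * t3' - p5 + X ^ 2 * p4 +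
    (X : PowerSeries ℤ) ^ (3 * n + 14) * key - (X : PowerSeries ℤ) ^ (2 * n + 11) * (1 + X) * a2
end

section
/- For every n ≥ 1, S^{1/16}_n = T^{1/16}_n as polynomials in ℤ[q]. -/
open PowerSeries

/-- `S^{1/16}_n = ∑_{k≥0} q^{2k²+k} binom(n-k, 2k+1)_q`; all summands with
`k > n` vanish, so the sum is taken over `k ≤ n`. -/
noncomputable def Ssixt (n : ℕ) : PowerSeries ℤ :=
  ∑ k ∈ Finset.range (n + 1),
    (X : PowerSeries ℤ) ^ (2 * k ^ 2 + k) * qBinom ((n : ℤ) - k) (2 * k + 1)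

/-- `T^{1/16}_n = ∑_{m,k≥0} q^{m²+3km+4k²} (q^{k+m} binom(n-3k-m-1,k)_q binom(n-4k-m-1,m)_q
+ q^{m+4k+1} binom(n-3k-m-2,k)_q binom(n-4k-m-2,m)_q)`; all summands with
`m > n` or `k > n` vanish. -/
noncomputable def Tsixt (n : ℕ) : PowerSeries ℤ :=
  ∑ m ∈ Finset.range (n + 1), ∑ k ∈ Finset.range (n + 1),
    (X : PowerSeries ℤ) ^ (m ^ 2 + 3 * k * m + 4 * k ^ 2) *
      ((X : PowerSeries ℤ) ^ (k + m) *
          qBinom ((n : ℤ) - 3 * k - m - 1) k * qBinom ((n : ℤ) - 4 * k - m - 1) m +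
        (X : PowerSeries ℤ) ^ (m + 4 * k + 1) *
          qBinom ((n : ℤ) - 3 * k - m - 2) k * qBinom ((n : ℤ) - 4 * k - m - 2) m)

namespace IsingAux

lemma qPoch_succ (n : ℕ) : qPoch (n + 1) = qPoch n * (1 - X ^ (n + 1)) := by
  simp [qPoch, Finset.prod_range_succ]

lemma qPoch_inv (n : ℕ) : qPoch n * qPochInv n = 1 := by
  apply PowerSeries.mul_invOfUnit
  simp [qPoch, map_prod]

lemma qPochInv_succ (n : ℕ) : qPochInv n = (1 - X ^ (n + 1)) * qPochInv (n + 1) := by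
  have h1 := qPoch_inv n
  have h2 := qPoch_inv (n + 1)
  rw [qPoch_succ] at h2
  linear_combination (-qPochInv n) * h2 + ((1 - X ^ (n + 1)) * qPochInv (n + 1)) * h1

lemma B_zero {m k : ℤ} (h : m < k) : qBinom m k = 0 := by
  unfold qBinom
  rw [if_neg]
  omega

lemma B_eq (k d : ℕ) : qBinom ((k : ℤ) + d) k = qPoch (k + d) * qPochInv k * qPochInv d := by
  unfold qBinom
  rw [if_pos (by omega)]
  rw [show ((k : ℤ) + d - k).toNat = d by omega]
  rfl

lemma B_eq' {m k : ℤ} (k' d : ℕ) (hk : k = k') (hm : m = k' + d) :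
    qBinom m k = qPoch (k' + d) * qPochInv k' * qPochInv d := by
  subst hk hm
  exact B_eq _ _

lemma B_self_zero (m : ℤ) (h : 0 ≤ m) : qBinom m 0 = 1 := by
  obtain ⟨d, rfl⟩ := Int.eq_ofNat_of_zero_le h
  rw [B_eq' 0 d (by simp) (by simp)]
  have h1 := qPoch_inv d
  have h0 := qPoch_inv 0
  simp only [zero_add]
  have : qPoch 0 = 1 := by simp [qPoch]
  rw [this] at h0
  linear_combination h1 + (qPoch d * qPochInv d) * h0

lemma B_succ_right (k d : ℕ) :
    qBinom ((k : ℤ) + d) (k + 1) = (1 - X ^ d) * (qPoch (k + d) * qPochInv (k + 1) * qPochInv d) := by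
  rcases d with _ | d
  · rw [B_zero (by simp)]
    simp
  · rw [B_eq' (k + 1) d (by push_cast; ring) (by push_cast; ring), qPochInv_succ d,
      show k + 1 + d = k + (d + 1) by ring]
    ring

lemma B_absorb (m : ℤ) (k e : ℕ) (he : (k : ℤ) ≤ m → (e : ℤ) = m - k) :
    (1 - X ^ (k + 1)) * qBinom m (k + 1) = (1 - X ^ e) * qBinom m k := by
  by_cases h : (k : ℤ) ≤ m
  · have he := he h
    obtain rfl : m = k + e := by omega
    rw [B_succ_right, B_eq, qPochInv_succ k]
    ring
  · rw [B_zero (by omega), B_zero (by omega)]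
    simp

lemma pas1 (m m' : ℤ) (k e : ℕ) (hm : m' = m + 1) (he : (k : ℤ) ≤ m → (e : ℤ) = m - k) :
    qBinom m' (k + 1) = qBinom m (k + 1) + X ^ e * qBinom m k := by
  subst hm
  by_cases h : (k : ℤ) ≤ m
  · have he := he h
    obtain rfl : m = k + e := by omega
    rw [B_succ_right, B_eq, qPochInv_succ k,
      B_eq' (m := k + e + 1) (k + 1) e (by push_cast; ring) (by push_cast; ring),
      show k + 1 + e = k + e + 1 by ring, qPoch_succ]
    ring
  · rw [B_zero (by omega), B_zero (by omega), B_zero (by omega)]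
    simp

lemma pas2 (m m' : ℤ) (k : ℕ) (hm : m' = m + 1) :
    qBinom m' (k + 1) = X ^ (k + 1) * qBinom m (k + 1) + qBinom m k := by
  have h1 := pas1 m m' k (m - k).toNat hm (by omega)
  have h2 := B_absorb m k (m - k).toNat (by omega)
  linear_combination h1 + h2

noncomputable def del (n : ℤ) : PowerSeries ℤ := if n = 0 then 1 else 0

lemma del_ne {n : ℤ} (h : n ≠ 0) : del n = 0 := if_neg h

lemma X_del {n : ℤ} (e f : ℕ) (h : n = 0 → e = f) : X ^ e * del n = X ^ f * del n := by
  by_cases hn : n = 0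
  · rw [h hn]
  · simp [del_ne hn]

lemma B_del (n : ℤ) : qBinom n 0 = qBinom (n - 1) 0 + del n := by
  rcases lt_trichotomy n 0 with h | h | h
  · rw [B_zero h, B_zero (by omega), del_ne h.ne]; simp
  · subst h
    rw [B_self_zero 0 le_rfl, B_zero (by omega)]
    simp [del]
  · rw [B_self_zero n h.le, B_self_zero _ (by omega), del_ne h.ne']; simp

/-! ### the double sums -/

noncomputable def tt (n : ℤ) (a b j k : ℕ) : PowerSeries ℤ :=
  X ^ (j ^ 2 + j * k + 2 * k ^ 2 + a * j + b * k) * (qBinom (n - 2 * k - j) j * qBinom j k)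

noncomputable def TT (n : ℤ) (a b : ℕ) : PowerSeries ℤ :=
  ∑ j ∈ Finset.range (n.toNat + 1), ∑ k ∈ Finset.range (n.toNat + 1), tt n a b j k

lemma tt_zero (n : ℤ) (a b j k : ℕ) (h : n < 2 * j + 2 * k ∨ j < k) : tt n a b j k = 0 := by
  unfold tt
  rcases h with h | h
  · rw [B_zero (by omega)]; simp
  · rw [B_zero (m := j) (by omega)]; simp

lemma rect (f : ℕ → ℕ → PowerSeries ℤ) (M A B : ℕ) (hA : M ≤ A) (hB : M ≤ B)
    (h : ∀ j k, M ≤ j ∨ M ≤ k → f j k = 0) :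
    ∑ j ∈ Finset.range A, ∑ k ∈ Finset.range B, f j k =
      ∑ j ∈ Finset.range M, ∑ k ∈ Finset.range M, f j k := by
  symm
  rw [← Finset.sum_subset (Finset.range_subset_range.2 hA)]
  · apply Finset.sum_congr rfl
    intro j _
    apply Finset.sum_subset (Finset.range_subset_range.2 hB)
    intro k _ hk
    exact h _ _ (by simp at hk; omega)
  · intro j _ hj
    apply Finset.sum_eq_zero
    intro k _
    exact h _ _ (by simp at hj; omega)

lemma TT_eq (n : ℤ) (a b A B : ℕ) (hA : n < A) (hB : n < B) :
    ∑ j ∈ Finset.range A, ∑ k ∈ Finset.range B, tt n a b j k = TT n a b := by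
  by_cases hn : 0 ≤ n
  · apply rect _ _ _ _ (by omega) (by omega)
    intro j k h
    apply tt_zero
    omega
  · have h0 : ∀ j k, tt n a b j k = 0 := fun j k => tt_zero _ _ _ _ _ (by omega)
    simp [TT, h0]

lemma TT_neg (n : ℤ) (a b : ℕ) (h : n < 0) : TT n a b = 0 := by
  rw [← TT_eq n a b 0 0 (by simpa using h) (by simpa using h)]
  simp

lemma TT_zero (a b : ℕ) : TT 0 a b = 1 := by
  simp [TT, tt, B_self_zero]

lemma sum_shift (f g h u : ℕ → ℕ → PowerSeries ℤ) (d : PowerSeries ℤ) (M : ℕ)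
    (h00 : f 0 0 = g 0 0 + d) (h0 : ∀ k, f 0 (k + 1) = g 0 (k + 1))
    (h1 : ∀ j, f (j + 1) 0 = g (j + 1) 0 + h j 0)
    (h2 : ∀ j k, f (j + 1) (k + 1) = g (j + 1) (k + 1) + h j (k + 1) + u j k) :
    ∑ j ∈ Finset.range (M + 1), ∑ k ∈ Finset.range (M + 1), f j k =
      ∑ j ∈ Finset.range (M + 1), ∑ k ∈ Finset.range (M + 1), g j k +
      ∑ j ∈ Finset.range M, ∑ k ∈ Finset.range (M + 1), h j k +
      ∑ j ∈ Finset.range M, ∑ k ∈ Finset.range M, u j k + d := by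
  simp only [Finset.sum_range_succ' _ M, h00, h0, h1, h2, Finset.sum_add_distrib]
  ring

lemma rel1 (n : ℤ) (a b c e : ℕ) (he : 2 ≤ n → (e : ℤ) = c + n - 1 + a) :
    X ^ c * TT n a b = X ^ c * TT (n - 1) a b + X ^ e * TT (n - 2) a b
      + X ^ (e + 1 + b) * TT (n - 4) (a + 1) (b + 3) + X ^ c * del n := by
  obtain ⟨M, hM⟩ : ∃ M : ℕ, n < M := ⟨n.toNat + 1, by omega⟩
  rw [← TT_eq n a b (M + 1) (M + 1) (by omega) (by omega),
    ← TT_eq (n - 1) a b (M + 1) (M + 1) (by omega) (by omega),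
    ← TT_eq (n - 2) a b M (M + 1) (by omega) (by omega),
    ← TT_eq (n - 4) (a + 1) (b + 3) M M (by omega) (by omega)]
  simp only [Finset.mul_sum]
  apply sum_shift
  · have := B_del n
    simp only [tt]
    simp [B_self_zero]
    linear_combination X ^ c * this
  · intro k
    rw [tt_zero _ _ _ _ _ (by omega), tt_zero _ _ _ _ _ (by omega)]
  · intro j
    have h1 := pas1 (n - 2 - j) (n - 1 - j) j (n - 2 - j - j).toNat (by ring) (by omega)
    simp only [tt]
    push_cast
    rw [B_self_zero _ (by positivity), B_self_zero _ (by positivity),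
      show n - 0 - ((j : ℤ) + 1) = n - 1 - j by ring,
      show n - 1 - 0 - ((j : ℤ) + 1) = n - 2 - j by ring,
      show n - 2 - 0 - (j : ℤ) = n - 2 - j by ring, h1]
    by_cases hj : (j : ℤ) ≤ n - 2 - j
    · have he := he (by omega)
      obtain ⟨f, hf⟩ : ∃ f : ℕ, (n - 2 - j - j) = f := ⟨(n - 2 - j - j).toNat, by omega⟩
      have : e = c + f + 1 + 2 * j + a := by omega
      subst this
      rw [hf, Int.toNat_natCast]
      ring
    · rw [B_zero (m := n - 2 - j) (k := j) (by omega)]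
      ring
  · intro j k
    have h1 := pas1 (n - 4 - 2 * k - j) (n - 3 - 2 * k - j) j (n - 4 - 2 * k - j - j).toNat
      (by ring) (by omega)
    have h2 := pas2 j (j + 1) k rfl
    simp only [tt]
    push_cast
    rw [show n - 2 * ((k : ℤ) + 1) - ((j : ℤ) + 1) = n - 3 - 2 * k - j by ring,
      show n - 1 - 2 * ((k : ℤ) + 1) - ((j : ℤ) + 1) = n - 4 - 2 * k - j by ring,
      show n - 2 - 2 * ((k : ℤ) + 1) - (j : ℤ) = n - 4 - 2 * k - j by ring, h1]
    by_cases hj : (j : ℤ) ≤ n - 4 - 2 * k - j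
    · have he := he (by omega)
      obtain ⟨f, hf⟩ : ∃ f : ℕ, (n - 4 - 2 * k - j - j) = f :=
        ⟨(n - 4 - 2 * k - j - j).toNat, by omega⟩
      have : e = c + f + 3 + 2 * k + 2 * j + a := by omega
      subst this
      rw [hf, Int.toNat_natCast, h2]
      ring
    · rw [B_zero (m := n - 4 - 2 * k - j) (k := j) (by omega)]
      ring

lemma rel2 (n : ℤ) (a b : ℕ) :
    TT n a b = TT (n - 1) (a + 1) b + X ^ (1 + a) * TT (n - 2) (a + 2) (b + 2)
      + X ^ (4 + a + b) * TT (n - 4) (a + 3) (b + 5) + del n := by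
  obtain ⟨M, hM⟩ : ∃ M : ℕ, n < M := ⟨n.toNat + 1, by omega⟩
  rw [← TT_eq n a b (M + 1) (M + 1) (by omega) (by omega),
    ← TT_eq (n - 1) (a + 1) b (M + 1) (M + 1) (by omega) (by omega),
    ← TT_eq (n - 2) (a + 2) (b + 2) M (M + 1) (by omega) (by omega),
    ← TT_eq (n - 4) (a + 3) (b + 5) M M (by omega) (by omega)]
  simp only [Finset.mul_sum]
  apply sum_shift
  · have := B_del n
    simp only [tt]
    simp [B_self_zero]
    linear_combination this
  · intro k
    rw [tt_zero _ _ _ _ _ (by omega), tt_zero _ _ _ _ _ (by omega)]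
  · intro j
    have h1 := pas2 (n - 2 - j) (n - 1 - j) j (by ring)
    simp only [tt]
    push_cast
    rw [B_self_zero _ (by positivity), B_self_zero _ (by positivity),
      show n - 0 - ((j : ℤ) + 1) = n - 1 - j by ring,
      show n - 1 - 0 - ((j : ℤ) + 1) = n - 2 - j by ring,
      show n - 2 - 0 - (j : ℤ) = n - 2 - j by ring, h1]
    ring
  · intro j k
    have h1 := pas2 (n - 4 - 2 * k - j) (n - 3 - 2 * k - j) j (by ring)
    have h2 := pas2 j (j + 1) k rfl
    simp only [tt]
    push_cast
    rw [show n - 2 * ((k : ℤ) + 1) - ((j : ℤ) + 1) = n - 3 - 2 * k - j by ring,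
      show n - 1 - 2 * ((k : ℤ) + 1) - ((j : ℤ) + 1) = n - 4 - 2 * k - j by ring,
      show n - 2 - 2 * ((k : ℤ) + 1) - (j : ℤ) = n - 4 - 2 * k - j by ring, h1]
    linear_combination (X ^ ((j + 1) ^ 2 + (j + 1) * (k + 1) + 2 * (k + 1) ^ 2 + a * (j + 1)
      + b * (k + 1)) * qBinom (n - 4 - 2 * k - j) j) * h2

lemma rel3 (n : ℤ) (a b : ℕ) :
    TT n a b + X ^ (2 + b) * TT (n - 2) (a + 2) (b + 3) =
      TT n a (b + 1) + X ^ (2 + b) * TT (n - 2) (a + 1) (b + 4) := by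
  obtain ⟨M, hM⟩ : ∃ M : ℕ, n < M := ⟨n.toNat + 1, by omega⟩
  rw [← TT_eq n a b M (M + 1) (by omega) (by omega),
    ← TT_eq n a (b + 1) M (M + 1) (by omega) (by omega),
    ← TT_eq (n - 2) (a + 2) (b + 3) M M (by omega) (by omega),
    ← TT_eq (n - 2) (a + 1) (b + 4) M M (by omega) (by omega)]
  simp only [Finset.mul_sum, ← Finset.sum_add_distrib]
  apply Finset.sum_congr rfl
  intro j _
  rw [Finset.sum_range_succ', Finset.sum_range_succ', add_right_comm, add_right_comm _ (tt _ _ _ _ 0),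
    ← Finset.sum_add_distrib, ← Finset.sum_add_distrib]
  congr 1
  · apply Finset.sum_congr rfl
    intro k _
    simp only [tt]
    push_cast
    rw [show n - 2 * ((k : ℤ) + 1) - (j : ℤ) = n - 2 - 2 * k - j by ring]
    by_cases hk : k ≤ j
    · obtain ⟨e, rfl⟩ := Nat.exists_eq_add_of_le hk
      have h := B_absorb ((k + e : ℕ) : ℤ) k e (by intro; push_cast; ring)
      linear_combination (X ^ ((k+e) ^ 2 + (k+e) * (k+1) + 2 * (k+1) ^ 2 + a * (k+e) + b * (k+1)) *
        qBinom (n - 2 - 2 * k - (k + e : ℕ)) (k + e : ℕ)) * h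
    · rw [B_zero (m := j) (k := k + 1) (by omega), B_zero (m := j) (k := k) (by omega)]
      ring

/-! ### the single sums -/

/-- `∑ q^(E k) [n-k, 2k+c]`. -/
noncomputable def SS (E : ℕ → ℕ) (c : ℕ) (n : ℤ) : PowerSeries ℤ :=
  ∑ k ∈ Finset.range (n.toNat + 1), X ^ (E k) * qBinom (n - k) (2 * k + c)

lemma SS_eq (E : ℕ → ℕ) (c : ℕ) (n : ℤ) (A : ℕ) (hA : n < A) :
    ∑ k ∈ Finset.range A, X ^ (E k) * qBinom (n - k) (2 * k + c) = SS E c n := by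
  by_cases hn : 0 ≤ n
  · symm
    apply Finset.sum_subset (Finset.range_subset_range.2 (by omega))
    intro k _ hk
    rw [B_zero (by simp at hk; omega)]
    simp
  · have h0 : ∀ k : ℕ, qBinom (n - k) (2 * k + c) = 0 := fun k => B_zero (by omega)
    simp [SS, h0]

lemma SS_neg (E : ℕ → ℕ) (c : ℕ) (n : ℤ) (h : n < 0) : SS E c n = 0 := by
  rw [← SS_eq E c n 0 (by simpa using h)]
  simp

/-- odd, `q^n`-type -/
lemma relA (E E' : ℕ → ℕ) (n : ℤ) (e : ℕ) (he : 1 ≤ n → (e : ℤ) = n - 1)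
    (hE : ∀ k, E k = E' k + 3 * k) :
    SS E 1 n = SS E 1 (n - 1) + X ^ e * SS E' 0 (n - 1) := by
  obtain ⟨M, hM⟩ : ∃ M : ℕ, n < M := ⟨n.toNat + 1, by omega⟩
  rw [← SS_eq _ _ n M (by omega), ← SS_eq _ _ (n - 1) M (by omega), ← SS_eq _ _ (n - 1) M (by omega),
    Finset.mul_sum, ← Finset.sum_add_distrib]
  apply Finset.sum_congr rfl
  intro k _
  have h := pas1 (n - 1 - k) (n - k) (2 * k) (n - 1 - 3 * k).toNat (by ring) (by push_cast; omega)
  push_cast at h ⊢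
  rw [h, hE, add_zero]
  by_cases hk : 2 * (k : ℤ) ≤ n - 1 - k
  · have : e = (n - 1 - 3 * k).toNat + 3 * k := by omega
    rw [this]
    ring
  · rw [B_zero (m := n - 1 - k) (k := 2 * k) (by omega)]
    ring

lemma relB (E E' : ℕ → ℕ) (n : ℤ) (hE : ∀ k, E' k = E k + 2 * k) :
    SS E 1 n = X * SS E' 1 (n - 1) + SS E 0 (n - 1) := by
  obtain ⟨M, hM⟩ : ∃ M : ℕ, n < M := ⟨n.toNat + 1, by omega⟩
  rw [← SS_eq _ _ n M (by omega), ← SS_eq _ _ (n - 1) M (by omega), ← SS_eq _ _ (n - 1) M (by omega),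
    Finset.mul_sum, ← Finset.sum_add_distrib]
  apply Finset.sum_congr rfl
  intro k _
  have h := pas2 (n - 1 - k) (n - k) (2 * k) (by ring)
  push_cast at h ⊢
  rw [h, hE, add_zero]
  ring

lemma relC (E E' : ℕ → ℕ) (n : ℤ) (e : ℕ) (h0 : E 0 = 0)
    (he : 3 ≤ n → ∀ k, E (k + 1) + n = E' k + e + 3 * k + 3) :
    SS E 0 n = SS E 0 (n - 1) + X ^ e * SS E' 1 (n - 2) + del n := by
  obtain ⟨M, hM⟩ : ∃ M : ℕ, n < M := ⟨n.toNat + 1, by omega⟩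
  rw [← SS_eq _ _ n (M + 1) (by omega), ← SS_eq _ _ (n - 1) (M + 1) (by omega),
    ← SS_eq _ _ (n - 2) M (by omega),
    Finset.mul_sum, Finset.sum_range_succ', Finset.sum_range_succ', add_right_comm _ _ (Finset.sum _ _),
    ← Finset.sum_add_distrib, add_assoc]
  congr 1
  · apply Finset.sum_congr rfl
    intro k _
    have h := pas1 (n - 2 - k) (n - 1 - k) (2 * k + 1) (n - 3 - 3 * k).toNat (by ring)
      (by push_cast; omega)
    push_cast at h ⊢
    rw [show n - ((k : ℤ) + 1) = n - 1 - k by ring, show n - 1 - ((k : ℤ) + 1) = n - 2 - k by ring,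
      show 2 * ((k : ℤ) + 1) + 0 = 2 * k + 1 + 1 by ring, h]
    by_cases hk : 2 * (k : ℤ) + 1 ≤ n - 2 - k
    · have := he (by omega) k
      have h2 : E (k + 1) + (n - 3 - 3 * k).toNat = E' k + e := by omega
      have h3 : (X : PowerSeries ℤ) ^ (E (k + 1)) * X ^ (n - 3 - 3 * k).toNat = X ^ E' k * X ^ e := by
        rw [← pow_add, ← pow_add, h2]
      linear_combination qBinom (n - 2 - k) (2 * k + 1) * h3
    · rw [B_zero (m := n - 2 - k) (k := 2 * k + 1) (by omega)]
      ring
  · have := B_del n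
    simp [h0]
    linear_combination this

lemma relD (E F G : ℕ → ℕ) (n : ℤ) (e : ℕ) (h0 : E 0 = 0) (h0' : F 0 = 0)
    (hF : ∀ k, F k = E k + 2 * k) (hG : ∀ k, E (k + 1) = G k + e) :
    SS E 0 n = SS F 0 (n - 1) + X ^ e * SS G 1 (n - 2) + del n := by
  obtain ⟨M, hM⟩ : ∃ M : ℕ, n < M := ⟨n.toNat + 1, by omega⟩
  rw [← SS_eq _ _ n (M + 1) (by omega), ← SS_eq _ _ (n - 1) (M + 1) (by omega),
    ← SS_eq _ _ (n - 2) M (by omega),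
    Finset.mul_sum, Finset.sum_range_succ', Finset.sum_range_succ', add_right_comm _ _ (Finset.sum _ _),
    ← Finset.sum_add_distrib, add_assoc]
  congr 1
  · apply Finset.sum_congr rfl
    intro k _
    have h := pas2 (n - 2 - k) (n - 1 - k) (2 * k + 1) (by ring)
    push_cast at h ⊢
    rw [show n - ((k : ℤ) + 1) = n - 1 - k by ring, show n - 1 - ((k : ℤ) + 1) = n - 2 - k by ring,
      show 2 * ((k : ℤ) + 1) + 0 = 2 * k + 1 + 1 by ring, h, hF, hG]
    ring
  · have := B_del n
    simp [h0, h0']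
    linear_combination this

noncomputable def s1 : ℤ → PowerSeries ℤ := SS (fun k => 2 * k ^ 2 + k) 1
noncomputable def s2 : ℤ → PowerSeries ℤ := SS (fun k => 2 * k ^ 2 + 2 * k) 1
noncomputable def r0 : ℤ → PowerSeries ℤ := SS (fun k => 2 * k ^ 2) 0
noncomputable def r1 : ℤ → PowerSeries ℤ := SS (fun k => 2 * k ^ 2 - k) 0

lemma s1_rec (n : ℤ) (e : ℕ) (he : (e : ℤ) = n - 1) :
    s1 n = s1 (n - 1) + X ^ e * (r0 (n - 2) + s2 (n - 3) + del (n - 1)) := by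
  have hk : ∀ k : ℕ, k ≤ k ^ 2 := fun k => Nat.le_self_pow (by norm_num) k
  have h1 := relA (fun k => 2 * k ^ 2 + k) (fun k => 2 * k ^ 2 - 2 * k) n e (fun _ => he)
    (by intro k; have := hk k; omega)
  have h2 := relD (fun k => 2 * k ^ 2 - 2 * k) (fun k => 2 * k ^ 2) (fun k => 2 * k ^ 2 + 2 * k) (n - 1) 0
    (by simp) (by simp) (by intro k; have := hk k; omega)
    (by 
      intro k
      have : 2 * (k + 1) ^ 2 = 2 * k ^ 2 + 2 * k + 2 * (k + 1) := by ring
      omega)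
  rw [show n - 1 - 1 = n - 2 by ring, show n - 1 - 2 = n - 3 by ring] at h2
  unfold s1 s2 r0
  rw [h1, h2]
  simp

lemma s2_rec (n : ℤ) (e : ℕ) (he : (e : ℤ) = n - 1) :
    s2 n = s2 (n - 1) + X ^ e * r1 (n - 1) := by
  have hk : ∀ k : ℕ, k ≤ k ^ 2 := fun k => Nat.le_self_pow (by norm_num) k
  exact relA _ _ n e (fun _ => he) (by intro k; have := hk k; omega)

lemma r0_rec (n : ℤ) (e : ℕ) (he : (e : ℤ) = n - 1) :
    r0 n = r0 (n - 1) + X ^ e * s1 (n - 2) := by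
  have := relC (fun k => 2 * k ^ 2) (fun k => 2 * k ^ 2 + k) n e (by simp)
    (by intro _ k; push_cast; rw [he]; ring)
  rw [del_ne (by omega), add_zero] at this
  exact this

lemma r1_rec (n : ℤ) (e : ℕ) (hn : 1 ≤ n) (he : 3 ≤ n → (e : ℤ) = n - 2) :
    r1 n = r1 (n - 1) + X ^ e * r0 (n - 3) + X ^ (e + 1) * s2 (n - 3) := by
  have h1 := relC (fun k => 2 * k ^ 2 - k) (fun k => 2 * k ^ 2) n e (by simp)
    (by
      intro h k
      have := he h
      have h2 : 2 * (k + 1) ^ 2 - (k + 1) = 2 * k ^ 2 + 3 * k + 1 := by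
        have : 2 * (k + 1) ^ 2 = 2 * k ^ 2 + 3 * k + 1 + (k + 1) := by ring
        omega
      simp only [h2]
      push_cast
      rw [this]
      ring)
  have h2 := relB (fun k => 2 * k ^ 2) (fun k => 2 * k ^ 2 + 2 * k) (n - 2) (by simp)
  rw [show n - 2 - 1 = n - 3 by ring] at h2
  rw [del_ne (by omega), add_zero, h2] at h1
  unfold r1 r0 s2
  rw [h1]
  ring

lemma main (N : ℕ) : ∀ n : ℤ, n ≤ N →
    s1 n = TT (n - 1) 1 0 + X * TT (n - 2) 1 3 ∧
    s2 n = TT (n - 1) 1 2 + X * TT (n - 2) 2 3 ∧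
    r0 n = TT n 0 0 - X * TT (n - 2) 2 2 ∧
    r1 n = TT (n - 1) 0 1 + X ^ 3 * TT (n - 4) 3 4 + del n := by
  induction N with
  | zero =>
    intro n hn
    rcases lt_or_eq_of_le hn with h | h
    · have h : n < 0 := by simpa using h
      simp only [s1, s2, r0, r1]
      rw [SS_neg _ _ _ h, SS_neg _ _ _ h, SS_neg _ _ _ h, SS_neg _ _ _ h, del_ne h.ne]
      simp (disch := omega) [TT_neg]
    · have h : n = 0 := by simpa using h
      subst h
      simp (disch := omega) [TT_neg, TT_zero, s1, s2, r0, r1, SS, del, B_self_zero, B_zero]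
  | succ N ih =>
    intro n hn
    rcases lt_or_eq_of_le hn with h | h
    · exact ih n (by push_cast at h; omega)
    push_cast at h
    have he : (N : ℤ) = n - 1 := by omega
    have hdn : del n = 0 := del_ne (by omega)
    obtain ⟨a1, a2, a3, a4⟩ := ih (n - 1) (by omega)
    obtain ⟨b1, b2, b3, b4⟩ := ih (n - 2) (by omega)
    obtain ⟨c1, c2, c3, c4⟩ := ih (n - 3) (by omega)
    have p1 := s1_rec n N he
    have p2 := s2_rec n N he
    have p3 := r0_rec n N he
    have p4 := r1_rec n (N - 1) (by omega) (by omega)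
    rw [a1, b3, c2] at p1
    rw [a2, a4] at p2
    rw [a3, b1] at p3
    rw [a4, c3, c2] at p4
    have e1 := X_del (n := n - 1) N 0 (by omega)
    have e2 := X_del (n := n - 2) N 1 (by omega)
    have e4 := X_del (n := n - 4) (N + 1) 4 (by omega)
    have e4' := X_del (n := n - 4) (N - 1 + 1) 3 (by omega)
    refine ⟨?_, ?_, ?_, ?_⟩
    · have q1 := rel1 (n - 1) 1 0 0 N (by push_cast; omega)
      have q2 := rel1 (n - 2) 1 3 1 N (by push_cast; omega)
      have q3 := rel3 (n - 4) 1 2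
      have q4 := rel2 (n - 2) 0 0
      simp only [sub_sub, Int.reduceAdd, Nat.reduceAdd] at p1 q1 q2 q3 q4
      linear_combination p1 - q1 - q2 + X ^ N * q4 + X ^ N * q3 + e1 + e2
    · have q1 := rel1 (n - 1) 1 2 0 N (by push_cast; omega)
      have q2 := rel1 (n - 2) 2 3 1 (N + 1) (by push_cast; omega)
      have q3 := rel3 (n - 3) 1 1
      have q4 := rel2 (n - 2) 0 1
      simp only [sub_sub, Int.reduceAdd, Nat.reduceAdd] at p2 q1 q2 q3 q4
      linear_combination p2 - q1 - q2 + X ^ N * q4 + X ^ N * q3 + e1 + e2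
    · have q1 := rel1 (n - 1) 1 0 0 N (by push_cast; omega)
      have q2 := rel1 (n - 4) 3 5 4 (N + 3) (by push_cast; omega)
      have q3 := rel2 (n - 4) 1 3
      have q4 := rel2 n 0 0
      have q5 := rel2 (n - 1) 0 0
      simp only [sub_sub, Int.reduceAdd, Nat.reduceAdd] at p3 q1 q2 q3 q4 q5
      linear_combination p3 - q4 + q5 - q1 - q2 + X ^ (N + 1) * q3 + e4 - hdn
    · have q1 := rel1 (n - 1) 0 1 0 (N - 1) (by push_cast; omega)
      have q2 := rel1 (n - 4) 3 4 3 (N - 1 + 3) (by push_cast; omega)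
      have q3 := rel3 (n - 3) 0 0
      have q4 := rel2 (n - 4) 1 2
      simp only [sub_sub, Int.reduceAdd, Nat.reduceAdd] at p4 q1 q2 q3 q4
      linear_combination p4 - q1 - q2 + X ^ (N - 1) * q3 + X ^ (N - 1 + 1) * q4 + e4' - hdn

lemma multinom (N k m : ℕ) :
    qBinom (N : ℤ) k * qBinom ((N : ℤ) - k) m =
      qBinom (N : ℤ) (m + k : ℕ) * qBinom ((m + k : ℕ) : ℤ) k := by
  by_cases h : m + k ≤ N
  · obtain ⟨d, rfl⟩ := Nat.exists_eq_add_of_le h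
    rw [B_eq' (m := ((m + k + d : ℕ) : ℤ)) (k := (k : ℤ)) k (m + d) rfl (by push_cast; ring),
      B_eq' (k := (m : ℤ)) m d rfl (by push_cast; ring),
      B_eq' (m := ((m + k + d : ℕ) : ℤ)) (m + k) d rfl (by push_cast; ring),
      B_eq' (m := ((m + k : ℕ) : ℤ)) k m rfl (by push_cast; ring),
      show k + (m + d) = m + k + d by ring, show k + m = m + k by ring]
    have h1 := qPoch_inv (m + d)
    have h2 := qPoch_inv (m + k)
    linear_combination (qPoch (m + k + d) * qPochInv k * qPochInv m * qPochInv d) * (h1 - h2)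
  · rw [B_zero (m := (N : ℤ)) (k := (m + k : ℕ)) (by omega), B_zero (m := (N : ℤ) - k) (by omega)]
    ring

lemma tt_conv (n N : ℤ) (k m : ℕ) (a b : ℕ) (hN : N = n - 3 * k - m) :
    tt n a b (m + k) k = X ^ (m ^ 2 + 3 * k * m + 4 * k ^ 2 + a * (m + k) + b * k) *
      (qBinom N k * qBinom (N - k) m) := by
  have hN' : n - 2 * (k : ℤ) - ((m + k : ℕ) : ℤ) = N := by rw [hN]; push_cast; ring
  simp only [tt]
  rw [hN']
  by_cases h : 0 ≤ N
  · obtain ⟨N', rfl⟩ := Int.eq_ofNat_of_zero_le h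
    rw [multinom N' k m]
    ring
  · rw [B_zero (m := N) (by omega), B_zero (m := N) (by omega)]
    ring

lemma sum_conv (n : ℤ) (a b M : ℕ) (hM : n < M) :
    ∑ m ∈ Finset.range M, ∑ k ∈ Finset.range M, tt n a b (m + k) k = TT n a b := by
  rw [← TT_eq n a b M M hM hM, Finset.sum_comm]
  nth_rewrite 2 [Finset.sum_comm]
  apply Finset.sum_congr rfl
  intro k _
  have h1 : ∑ j ∈ Finset.range (k + M), tt n a b j k = ∑ j ∈ Finset.range M, tt n a b j k := by
    symm
    apply Finset.sum_subset (Finset.range_subset_range.2 (by omega))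
    intro j _ hj
    apply tt_zero
    simp at hj
    omega
  rw [← h1, Finset.sum_range_add, Finset.sum_eq_zero (s := Finset.range k), zero_add]
  · simp only [add_comm]
  · intro j hj
    apply tt_zero
    simp at hj
    omega

end IsingAux

/-- for every `n ≥ 1`, `S^{1/16}_n = T^{1/16}_n`. -/
theorem Ssixt_eq_Tsixt (n : ℕ) (hn : 1 ≤ n) : Ssixt n = Tsixt n := by
  have h := (IsingAux.main n n le_rfl).1
  have hS : Ssixt n = IsingAux.s1 n := by
    simp [Ssixt, IsingAux.s1, IsingAux.SS]
  rw [hS, h, ← IsingAux.sum_conv ((n : ℤ) - 1) 1 0 (n + 1) (by push_cast; omega),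
    ← IsingAux.sum_conv ((n : ℤ) - 2) 1 3 (n + 1) (by push_cast; omega)]
  simp only [Tsixt, Finset.mul_sum, ← Finset.sum_add_distrib]
  apply Finset.sum_congr rfl
  intro m _
  apply Finset.sum_congr rfl
  intro k _
  rw [IsingAux.tt_conv (n - 1) (n - 3 * k - m - 1) k m 1 0 (by ring),
    IsingAux.tt_conv (n - 2) (n - 3 * k - m - 2) k m 1 3 (by ring),
    show (n : ℤ) - 3 * k - m - 1 - k = n - 4 * k - m - 1 by ring,
    show (n : ℤ) - 3 * k - m - 2 - k = n - 4 * k - m - 2 by ring]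
  ring
end
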